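/- arXiv:2105.02159 — 9 statements merged into one kernel-verified Lean document; each statement's English description precedes it below -/
import Mathlib

section
/- Let S be a monoid with zero (0 ≠ 1), let P be a nonempty S-act that is projective in the category of S-acts, and let p : P → Q realize the Rees quotient P/0P, where Q is a pointed S-act. Then Q is projective in the category of pointed S-acts: for all pointed S-acts A, B, every surjective equivariant zero-preserving map π : A → B, and every equivariant zero-preserving f : Q → B, there exists an equivariant zero-preserving h : Q → A with π ∘ h = f. -/
universe u

def IsReesQuotientMap (S : Type u) [MonoidWithZero S] {A Q : Type u}
    [MulAction S A] [Zero Q] [MulActionWithZero S Q] (p : A → Q) : Prop :=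
  Function.Surjective p ∧ (∀ (s : S) (a : A), p (s • a) = s • p a) ∧
    ∀ a b : A, p a = p b ↔ a = b ∨ ((0 : S) • a = a ∧ (0 : S) • b = b)

/-- `P` is projective in the category of `S`-acts. -/
def ActProjective (S : Type u) [Monoid S] (P : Type u) [MulAction S P] : Prop :=
  ∀ (A B : Type u) [MulAction S A] [MulAction S B] (π : A → B) (f : P → B),
    Function.Surjective π → (∀ (s : S) (a : A), π (s • a) = s • π a) →
    (∀ (s : S) (x : P), f (s • x) = s • f x) →
    ∃ h : P → A, (∀ (s : S) (x : P), h (s • x) = s • h x) ∧ π ∘ h = f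

/-- if `P` is a nonempty projective `S`-act and `p : P → Q`
realizes the Rees quotient `P/0P`, then `Q` is projective in the category of
pointed `S`-acts. -/
theorem stmt_5 {S : Type u} [MonoidWithZero S] (h01 : (0 : S) ≠ 1)
    {P : Type u} [MulAction S P] [Nonempty P] (hP : ActProjective S P)
    {Q : Type u} [Zero Q] [MulActionWithZero S Q] (p : P → Q)
    (hp : IsReesQuotientMap S p) :
    ∀ (A B : Type u) [Zero A] [Zero B] [MulActionWithZero S A]
      [MulActionWithZero S B] (π : A → B) (f : Q → B),
      Function.Surjective π → (∀ (s : S) (a : A), π (s • a) = s • π a) →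
      π 0 = 0 →
      (∀ (s : S) (q : Q), f (s • q) = s • f q) → f 0 = 0 →
      ∃ h : Q → A,
        (∀ (s : S) (q : Q), h (s • q) = s • h q) ∧ h 0 = 0 ∧ π ∘ h = f := by
  intro A B _ _ _ _ π f hπ hπS _ hfS _
  obtain ⟨hpsurj, hpS, hpeq⟩ := hp
  obtain ⟨g, hgS, hg⟩ := hP A B π (f ∘ p) hπ hπS fun s x => by
    simp only [Function.comp_apply, hpS, hfS]
  have g_zero : ∀ x : P, (0 : S) • x = x → g x = 0 := fun x hx => by
    rw [← hx, hgS, zero_smul]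
  have hcomp : ∀ x, g (Function.surjInv hpsurj (p x)) = g x := fun x => by
    obtain h | ⟨h₁, h₂⟩ := (hpeq _ _).1 (Function.surjInv_eq hpsurj (p x))
    · rw [h]
    · rw [g_zero _ h₁, g_zero _ h₂]
  refine ⟨fun q => g (Function.surjInv hpsurj q), fun s q => ?_, ?_, funext fun q => ?_⟩
  · obtain ⟨x, rfl⟩ := hpsurj q
    simp only [← hpS, hcomp, hgS]
  · obtain ⟨x⟩ := ‹Nonempty P›
    have h : p ((0 : S) • x) = 0 := by rw [hpS, zero_smul]
    simp only [← h, hcomp, hgS, zero_smul]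
  · obtain ⟨x, rfl⟩ := hpsurj q
    simpa only [Function.comp_apply, hcomp] using congrFun hg x
end

section
/- Let S be a monoid with zero (0 ≠ 1) and let A be a pointed S-act that is projective and indecomposable in the category of pointed S-acts. Then there exists an idempotent e ∈ S (e*e = e) and an equivariant zero-preserving bijection from A onto the subact S • e = {s*e : s ∈ S} of S (where S acts on itself by left multiplication). -/
universe u

/-- A subact of a pointed `S`-act: a subset containing `0` and closed under
the action. -/
def IsPSubact (S : Type u) [MonoidWithZero S] {A : Type u} [Zero A]
    [MulActionWithZero S A] (B : Set A) : Prop :=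
  (0 : A) ∈ B ∧ ∀ (s : S) ⦃a : A⦄, a ∈ B → s • a ∈ B

/-- `P` is projective in the category of pointed `S`-acts. -/
def PActProjective (S : Type u) [MonoidWithZero S] (P : Type u) [Zero P]
    [MulActionWithZero S P] : Prop :=
  ∀ (B C : Type u) [Zero B] [Zero C] [MulActionWithZero S B]
    [MulActionWithZero S C] (π : B → C) (f : P → C),
    Function.Surjective π → (∀ (s : S) (b : B), π (s • b) = s • π b) →
    π 0 = 0 →
    (∀ (s : S) (x : P), f (s • x) = s • f x) → f 0 = 0 →
    ∃ h : P → B,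
      (∀ (s : S) (x : P), h (s • x) = s • h x) ∧ h 0 = 0 ∧ π ∘ h = f

/-- A pointed `S`-act is indecomposable if it is not the union of two proper
subacts intersecting in `{0}`. -/
def PIndecomposable (S : Type u) [MonoidWithZero S] (A : Type u) [Zero A]
    [MulActionWithZero S A] : Prop :=
  ¬ ∃ B C : Set A, IsPSubact S B ∧ IsPSubact S C ∧ B ≠ Set.univ ∧
      C ≠ Set.univ ∧ B ∪ C = Set.univ ∧ B ∩ C = {0}

/-- The zero element of a subact. -/
abbrev IsPSubact.zero {S : Type u} [MonoidWithZero S] {M : Type u} [Zero M]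
    [MulActionWithZero S M] {B : Set M} (hB : IsPSubact S B) : Zero B :=
  ⟨⟨0, hB.1⟩⟩

/-- A subact is itself a pointed act. -/
abbrev IsPSubact.mulActionWithZero {S : Type u} [MonoidWithZero S] {M : Type u} [Zero M]
    [MulActionWithZero S M] {B : Set M} (hB : IsPSubact S B) :
    letI := hB.zero
    MulActionWithZero S B :=
  letI := hB.zero
  { smul := fun s b => ⟨s • (b : M), hB.2 s b.2⟩
    one_smul := fun b => Subtype.ext (one_smul S (b : M))
    mul_smul := fun s t b => Subtype.ext (mul_smul s t (b : M))
    smul_zero := fun s => Subtype.ext (smul_zero s)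
    zero_smul := fun b => Subtype.ext (zero_smul S (b : M)) }

/-- The graph of the canonical map from the free pointed act on `A` to `A`; the free act
consists of the functions `A → S` with at most one nonzero value. -/
def freePActGraph (S A : Type u) [MonoidWithZero S] [Zero A] [MulActionWithZero S A] :
    Set ((A → S) × A) :=
  {p | ∃ a, (∀ b, b ≠ a → p.1 b = 0) ∧ p.2 = p.1 a • a}

theorem isPSubact_freePActGraph (S A : Type u) [MonoidWithZero S] [Zero A]
    [MulActionWithZero S A] : IsPSubact S (freePActGraph S A) := by
  refine ⟨⟨0, by simp⟩, ?_⟩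
  rintro s p ⟨a, h, hp⟩
  refine ⟨a, fun b hb => ?_, ?_⟩
  · simp [h b hb]
  · simp [hp, mul_smul]

/-- A projective pointed act embeds equivariantly into the free act on its elements, as a
section of the canonical map. -/
theorem PActProjective.exists_section {S : Type u} [MonoidWithZero S] {A : Type u} [Zero A]
    [MulActionWithZero S A] (hproj : PActProjective S A) :
    ∃ g : A → A → S, (∀ (s : S) (x a : A), g (s • x) a = s * g x a) ∧ (∀ a, g 0 a = 0) ∧
      ∀ x, ∃ a, (∀ b, b ≠ a → g x b = 0) ∧ x = g x a • a := by
  classical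
  have hF := isPSubact_freePActGraph S A
  let := hF.zero
  let := hF.mulActionWithZero
  obtain ⟨h, hsmul, hzero, hsec⟩ := hproj (freePActGraph S A) A (fun p => p.1.2) id
    (fun a => ⟨⟨(Pi.single a 1, a), a, fun b hb => by simp [hb], by simp⟩, rfl⟩)
    (fun _ _ => rfl) rfl (fun _ _ => rfl) rfl
  refine ⟨fun x => (h x).1.1, fun s x a => ?_, fun a => ?_, fun x => ?_⟩
  · exact congrArg (fun p => p.1.1 a) (hsmul s x)
  · exact congrArg (fun p => p.1.1 a) hzero
  · obtain ⟨a, ha, hx⟩ := (h x).2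
    exact ⟨a, ha, (congrFun hsec x).symm.trans hx⟩

/-- an indecomposable projective pointed `S`-act is isomorphic,
via an equivariant zero-preserving bijection, to `S • e = {s * e : s ∈ S}`
for some idempotent `e ∈ S`. -/
theorem stmt_6 {S : Type u} [MonoidWithZero S] (h01 : (0 : S) ≠ 1)
    {A : Type u} [Zero A] [MulActionWithZero S A]
    (hproj : PActProjective S A) (hind : PIndecomposable S A) :
    ∃ e : S, e * e = e ∧
      ∃ φ : A → S, Function.Injective φ ∧
        Set.range φ = {x : S | ∃ s : S, x = s * e} ∧ φ 0 = 0 ∧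
        ∀ (s : S) (a : A), φ (s • a) = s * φ a := by
  obtain ⟨g, hsmul, hzero, hg⟩ := hproj.exists_section
  by_cases hA : ∀ x a, g x a = 0
  · have hx (x : A) : x = 0 := by
      obtain ⟨a, -, ha⟩ := hg x
      rw [ha, hA, zero_smul]
    refine ⟨0, mul_zero 0, fun _ => 0, fun x y _ => (hx x).trans (hx y).symm, ?_, rfl, by simp⟩
    ext s
    simp
  push Not at hA
  obtain ⟨x₀, a, hx₀⟩ := hA
  have hB : {x | (∀ b, b ≠ a → g x b = 0) ∧ x = g x a • a} = Set.univ := by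
    by_contra hne
    refine hind ⟨_, {x | g x a = 0}, ?_,
      ⟨hzero a, ?_⟩, hne, fun h => hx₀ (h.ge (Set.mem_univ x₀)), ?_, ?_⟩
    · refine ⟨⟨fun b _ => hzero b, by simp [hzero]⟩, ?_⟩
      rintro s x ⟨hx, hxa⟩
      refine ⟨fun b hb => by rw [hsmul, hx b hb, mul_zero], ?_⟩
      rw [hsmul, mul_smul, ← hxa]
    · intro s x (hx : g x a = 0)
      exact (hsmul s x a).trans (by rw [hx, mul_zero])
    · refine Set.eq_univ_of_forall fun x => ?_
      obtain ⟨c, hc, hxc⟩ := hg x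
      by_cases hac : a = c
      · subst hac
        exact Or.inl ⟨hc, hxc⟩
      · exact Or.inr (hc a hac)
    · ext x
      constructor
      · rintro ⟨⟨-, hxa⟩, hx : g x a = 0⟩
        rw [hx, zero_smul] at hxa
        exact hxa
      · rintro rfl
        exact ⟨⟨fun b _ => hzero b, by simp [hzero]⟩, hzero a⟩
  have hgen (x : A) : x = g x a • a := (hB.ge (Set.mem_univ x)).2
  have hmul (x : A) : g x a = g x a * g a a := by
    rw [← hsmul, ← hgen]
  refine ⟨g a a, (hmul a).symm, fun x => g x a, fun x y hxy => ?_, ?_, hzero a,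
    fun s x => hsmul s x a⟩
  · rw [hgen x, hgen y]
    exact congrArg (· • a) hxy
  · ext s
    constructor
    · rintro ⟨x, rfl⟩
      exact ⟨g x a, hmul x⟩
    · rintro ⟨t, rfl⟩
      exact ⟨t • a, hsmul t a a⟩
end

section
/- Let S be a monoid with zero (0 ≠ 1). A pointed S-act A is projective in the category of pointed S-acts if and only if there exist an index set I, idempotents e_i ∈ S for i ∈ I, and subacts A_i ⊆ A with ⋃_{i∈I} A_i = A, A_i ∩ A_j = {0} for all i ≠ j, and for each i an equivariant zero-preserving bijection from A_i onto S • e_i (i.e. A is the coproduct in the category of pointed S-acts of acts of the form S e_i with e_i idempotent). -/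
universe u

/-- The free pointed `S`-act on `X`: functions `X → S` supported on at most one point. -/
def FreePAct (S : Type u) [MonoidWithZero S] (X : Type u) : Type u :=
  {f : X → S // ∀ a b, f a ≠ 0 → f b ≠ 0 → a = b}

namespace FreePAct

variable {S : Type u} [MonoidWithZero S] {X : Type u}

instance : Zero (FreePAct S X) :=
  ⟨⟨fun _ => 0, fun _ _ h => absurd rfl h⟩⟩

instance : MulActionWithZero S (FreePAct S X) where
  smul s f := ⟨fun x => s * f.1 x, fun a b ha hb =>
    f.2 a b (right_ne_zero_of_mul ha) (right_ne_zero_of_mul hb)⟩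
  one_smul f := Subtype.ext (funext fun x => one_mul (f.1 x))
  mul_smul s t f := Subtype.ext (funext fun x => mul_assoc s t (f.1 x))
  smul_zero s := Subtype.ext (funext fun _ => mul_zero s)
  zero_smul f := Subtype.ext (funext fun x => zero_mul (f.1 x))

theorem smul_val (s : S) (f : FreePAct S X) (x : X) : (s • f).1 x = s * f.1 x := rfl

theorem zero_val (x : X) : (0 : FreePAct S X).1 x = 0 := rfl

open Classical in
/-- The basis element of the free pointed act at `x`. -/
noncomputable def single (x : X) : FreePAct S X :=
  ⟨Pi.single x 1, fun a b ha hb => by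
    rw [Pi.single_apply] at ha hb
    rw [(ite_ne_right_iff.1 ha).1, (ite_ne_right_iff.1 hb).1]⟩

theorem exists_support_subset [Nonempty X] (f : FreePAct S X) :
    ∃ a, ∀ b, b ≠ a → f.1 b = 0 := by
  by_cases h : ∃ a, f.1 a ≠ 0
  · obtain ⟨a, ha⟩ := h
    exact ⟨a, fun b hb => by_contra fun h => hb (f.2 b a h ha)⟩
  · push Not at h
    exact ⟨Classical.arbitrary X, fun b _ => h b⟩

variable {A : Type u} [Zero A] [MulActionWithZero S A]

open Classical in
/-- The canonical map from the free pointed act on the points of `A` to `A`. -/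
noncomputable def counit (f : FreePAct S A) : A :=
  if h : ∃ a, f.1 a ≠ 0 then f.1 h.choose • h.choose else 0

theorem counit_eq (f : FreePAct S A) (a : A) (hf : ∀ b, b ≠ a → f.1 b = 0) :
    f.counit = f.1 a • a := by
  unfold counit
  split_ifs with h
  · have : h.choose = a := by_contra fun hne => h.choose_spec (hf _ hne)
    rw [this]
  · push Not at h
    rw [h a, zero_smul]

theorem counit_single (a : A) : (single a : FreePAct S A).counit = a := by
  classical
  rw [counit_eq _ a fun b hb => by simp [single, hb]]
  simp [single]

theorem counit_zero : (0 : FreePAct S A).counit = 0 := by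
  rw [counit_eq 0 0 fun _ _ => rfl, smul_zero]

theorem counit_smul (s : S) (f : FreePAct S A) : (s • f).counit = s • f.counit := by
  have : Nonempty A := ⟨0⟩
  obtain ⟨a, ha⟩ := f.exists_support_subset
  rw [counit_eq f a ha, counit_eq (s • f) a fun b hb => by rw [smul_val, ha b hb, mul_zero],
    smul_val, mul_smul]

end FreePAct

section

variable {S : Type u} [MonoidWithZero S] {A : Type u} [Zero A] [MulActionWithZero S A]

/-- A projective pointed act is a coproduct of acts generated by idempotents. -/
theorem PActProjective.exists_decomposition (hA : PActProjective S A) :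
    ∃ (I : Type u) (e : I → S) (B : I → Set A),
      (∀ i, e i * e i = e i) ∧ (∀ i, IsPSubact S (B i)) ∧
      (⋃ i, B i) = Set.univ ∧
      (∀ i j, i ≠ j → B i ∩ B j = {0}) ∧
      ∀ i, ∃ φ : A → S, Set.InjOn φ (B i) ∧
        φ '' B i = {x : S | ∃ s : S, x = s * e i} ∧ φ 0 = 0 ∧
        ∀ (s : S) (a : A), a ∈ B i → φ (s • a) = s * φ a := by
  obtain ⟨h, h_smul, h_zero, h_comp⟩ := hA (FreePAct S A) A FreePAct.counit id
    (fun a => ⟨_, FreePAct.counit_single a⟩) FreePAct.counit_smul FreePAct.counit_zero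
    (fun _ _ => rfl) rfl
  have h_counit (x : A) : (h x).counit = x := congrFun h_comp x
  let B (a : A) : Set A := {x | ∀ b, b ≠ a → (h x).1 b = 0}
  have eq_smul {a x : A} (hx : x ∈ B a) : x = (h x).1 a • a := by
    rw [← FreePAct.counit_eq (h x) a hx, h_counit]
  have val_smul (s : S) (x b : A) : (h (s • x)).1 b = s * (h x).1 b := by
    rw [h_smul, FreePAct.smul_val]
  have val_zero (b : A) : (h 0).1 b = 0 := by rw [h_zero, FreePAct.zero_val]
  have B_zero (a : A) : (0 : A) ∈ B a := fun b _ => val_zero b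
  have B_smul (a : A) (s : S) {x : A} (hx : x ∈ B a) : s • x ∈ B a := fun b hb => by
    rw [val_smul, hx b hb, mul_zero]
  have exists_idem (a : A) : ∃ e : S, e * e = e ∧
      (fun x => (h x).1 a) '' B a = {x : S | ∃ s : S, x = s * e} := by
    by_cases haB : a ∈ B a
    · refine ⟨(h a).1 a, ?_, ?_⟩
      · rw [← val_smul, ← eq_smul haB]
      · ext y
        constructor
        · rintro ⟨x, hx, rfl⟩
          refine ⟨(h x).1 a, ?_⟩
          rw [← val_smul, ← eq_smul hx]
        · rintro ⟨s, rfl⟩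
          exact ⟨s • a, B_smul a s haB, val_smul s a a⟩
    · refine ⟨0, mul_zero 0, ?_⟩
      have key : ∀ x ∈ B a, (h x).1 a = 0 := by
        intro x hx
        by_contra hne
        refine haB fun b hb => by_contra fun hb0 => hb ((h a).2 b a hb0 fun ha0 => hne ?_)
        rw [eq_smul hx, val_smul, ha0, mul_zero]
      ext y
      constructor
      · rintro ⟨x, hx, rfl⟩
        exact ⟨0, by rw [mul_zero]; exact key x hx⟩
      · rintro ⟨s, rfl⟩
        exact ⟨0, B_zero a, by rw [mul_zero]; exact val_zero a⟩
  choose e he himage using exists_idem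
  refine ⟨A, e, B, he, fun a => ⟨B_zero a, fun s _ hx => B_smul a s hx⟩, ?_, ?_, ?_⟩
  · refine Set.eq_univ_of_forall fun x => Set.mem_iUnion.2 ?_
    have : Nonempty A := ⟨0⟩
    exact (h x).exists_support_subset
  · intro i j hij
    refine Set.Subset.antisymm ?_ (Set.singleton_subset_iff.2 ⟨B_zero i, B_zero j⟩)
    rintro x ⟨hi, hj⟩
    rw [Set.mem_singleton_iff, eq_smul hi, hj i hij, zero_smul]
  · intro a
    refine ⟨fun x => (h x).1 a, ?_, himage a, val_zero a, fun s x _ => val_smul s x a⟩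
    intro x hx y hy hxy
    rw [eq_smul hx, eq_smul hy]
    exact congrArg (· • a) hxy

/-- A coproduct of acts generated by idempotents is projective. -/
theorem PActProjective.of_decomposition {I : Type u} {e : I → S} {B : I → Set A}
    (he : ∀ i, e i * e i = e i) (hB : ∀ i, IsPSubact S (B i))
    (hcover : (⋃ i, B i) = Set.univ) (hdisj : ∀ i j, i ≠ j → B i ∩ B j = {0})
    (hiso : ∀ i, ∃ φ : A → S, Set.InjOn φ (B i) ∧
      φ '' B i = {x : S | ∃ s : S, x = s * e i} ∧ φ 0 = 0 ∧
      ∀ (s : S) (a : A), a ∈ B i → φ (s • a) = s * φ a) :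
    PActProjective S A := by
  intro M N _ _ _ _ π f hπ π_smul _ f_smul _
  choose φ φ_inj φ_image φ_zero φ_smul using hiso
  have exists_gen (i : I) : ∃ a ∈ B i, φ i a = e i := by
    have : e i ∈ φ i '' B i := by
      rw [φ_image]
      exact ⟨1, (one_mul _).symm⟩
    exact this
  choose g g_mem φ_g using exists_gen
  have smul_g {i : I} {x : A} (hx : x ∈ B i) : φ i x • g i = x := by
    refine φ_inj i ((hB i).2 _ (g_mem i)) hx ?_
    obtain ⟨s, hs⟩ : φ i x ∈ {y : S | ∃ s : S, y = s * e i} :=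
      φ_image i ▸ Set.mem_image_of_mem _ hx
    rw [φ_smul i _ _ (g_mem i), φ_g, hs, mul_assoc, he]
  choose m hm using fun i => hπ (f (g i))
  have exists_index (x : A) : ∃ i, x ∈ B i := Set.mem_iUnion.1 (hcover ▸ Set.mem_univ x)
  choose k hk using exists_index
  have lift_eq {i : I} {x : A} (hx : x ∈ B i) : φ (k x) x • m (k x) = φ i x • m i := by
    by_cases hi : k x = i
    · rw [hi]
    · have hx0 : x = 0 := by
        have : x ∈ B (k x) ∩ B i := ⟨hk x, hx⟩
        rwa [hdisj _ _ hi] at this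
      rw [hx0, φ_zero, φ_zero, zero_smul, zero_smul]
  refine ⟨fun x => φ (k x) x • m (k x), fun s x => ?_, ?_, funext fun x => ?_⟩
  · change φ (k (s • x)) (s • x) • m (k (s • x)) = s • φ (k x) x • m (k x)
    rw [lift_eq ((hB (k x)).2 s (hk x)), φ_smul _ _ _ (hk x), mul_smul]
  · change φ (k 0) 0 • m (k 0) = 0
    rw [φ_zero, zero_smul]
  · change π (φ (k x) x • m (k x)) = f x
    rw [π_smul, hm, ← f_smul, smul_g (hk x)]

end

/-- a pointed `S`-act `A` is projective iff it is the coproduct,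
in the category of pointed `S`-acts, of acts `S • eᵢ` with `eᵢ ∈ S`
idempotent: there are subacts `Aᵢ` covering `A`, pairwise intersecting in
`{0}`, each isomorphic to some `S • eᵢ` via an equivariant zero-preserving
bijection. -/
theorem stmt_7 {S : Type u} [MonoidWithZero S] (h01 : (0 : S) ≠ 1)
    (A : Type u) [Zero A] [MulActionWithZero S A] :
    PActProjective S A ↔
      ∃ (I : Type u) (e : I → S) (B : I → Set A),
        (∀ i, e i * e i = e i) ∧ (∀ i, IsPSubact S (B i)) ∧
        (⋃ i, B i) = Set.univ ∧
        (∀ i j, i ≠ j → B i ∩ B j = {0}) ∧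
        ∀ i, ∃ φ : A → S, Set.InjOn φ (B i) ∧
          φ '' B i = {x : S | ∃ s : S, x = s * e i} ∧ φ 0 = 0 ∧
          ∀ (s : S) (a : A), a ∈ B i → φ (s • a) = s * φ a := by
  constructor
  · exact PActProjective.exists_decomposition
  · rintro ⟨I, e, B, he, hB, hcover, hdisj, hiso⟩
    exact PActProjective.of_decomposition he hB hcover hdisj hiso
end

section
/- Let S be a monoid with zero (0 ≠ 1) and let A be a nonempty indecomposable S-act. Then the set 0A of zero elements of A is a superfluous subact of A: for every proper subact C ⊊ A one has 0A ∪ C ≠ A. -/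
universe u

/-- The set of zero elements `0A = {z | 0 • z = z}` of an `S`-act `A`. -/
def zeroSet (S : Type u) [MonoidWithZero S] (A : Type u) [MulAction S A] :
    Set A :=
  {z : A | (0 : S) • z = z}

/-- A subact of an `S`-act: a nonempty subset closed under the action
(acts, hence subacts, are nonempty). -/
def IsSubact (S : Type u) [Monoid S] {A : Type u} [MulAction S A]
    (B : Set A) : Prop :=
  B.Nonempty ∧ ∀ (s : S) ⦃a : A⦄, a ∈ B → s • a ∈ B

/-- An `S`-act is indecomposable if it is not the disjoint union of two
nonempty proper subacts. -/
def ActIndecomposable (S : Type u) [Monoid S] (A : Type u) [MulAction S A] :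
    Prop :=
  ¬ ∃ B C : Set A, IsSubact S B ∧ IsSubact S C ∧ B ∩ C = ∅ ∧
      B ∪ C = Set.univ

/-- Every zero element of an act is fixed by the whole monoid. -/
theorem smul_eq_self_of_mem_zeroSet {S : Type u} [MonoidWithZero S]
    {A : Type u} [MulAction S A] {z : A} (hz : z ∈ zeroSet S A) (s : S) :
    s • z = z := by
  have hz' : (0 : S) • z = z := hz
  rw [← hz', smul_smul, mul_zero]

/-- in a nonempty indecomposable `S`-act `A`, the set `0A` of
zero elements is a superfluous subact: `0A ∪ C ≠ A` for every proper
subact `C ⊊ A`. -/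
theorem stmt_8 {S : Type u} [MonoidWithZero S] (h01 : (0 : S) ≠ 1)
    {A : Type u} [MulAction S A] [Nonempty A]
    (hind : ActIndecomposable S A) :
    ∀ C : Set A, IsSubact S C → C ≠ Set.univ →
      zeroSet S A ∪ C ≠ Set.univ := by
  intro C hC hne hU
  refine hind ⟨C, Cᶜ, hC, ⟨Set.nonempty_compl.mpr hne, fun s a ha => ?_⟩,
    Set.inter_compl_self C, Set.union_compl_self C⟩
  have hz : a ∈ zeroSet S A :=
    (hU.symm ▸ Set.mem_univ a : a ∈ zeroSet S A ∪ C).resolve_right ha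
  rwa [smul_eq_self_of_mem_zeroSet hz s]
end

section
/- Let S be a monoid with zero (0 ≠ 1), let f : P → A be a projective cover of a nonempty S-act A in the category of S-acts, let p_P : P → Q_P and p_A : A → Q_A realize the Rees quotients P/0P and A/0A, and let g : Q_P → Q_A be the induced equivariant zero-preserving map with g ∘ p_P = p_A ∘ f. Then g is a projective cover of Q_A in the category of pointed S-acts: Q_P is projective as a pointed S-act, g is surjective, and g(B) ≠ Q_A for every proper subact B ⊊ Q_P. -/
universe u

/-- if `f : P → A` is a projective cover in the category of
`S`-acts, `p_P, p_A` realize the Rees quotients and `g : Q_P → Q_A` is the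
induced map, then `g` is a projective cover of `Q_A` in the category of
pointed `S`-acts. -/
theorem stmt_10 {S : Type u} [MonoidWithZero S] (h01 : (0 : S) ≠ 1)
    {P A : Type u} [MulAction S P] [MulAction S A] [Nonempty A]
    (f : P → A) (hf_surj : Function.Surjective f)
    (hf_equiv : ∀ (s : S) (x : P), f (s • x) = s • f x)
    (hP_proj : ActProjective S P)
    (hf_cover : ∀ B : Set P, IsSubact S B → B ≠ Set.univ →
      f '' B ≠ Set.univ)
    {QP QA : Type u} [Zero QP] [Zero QA] [MulActionWithZero S QP]
    [MulActionWithZero S QA]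
    (pP : P → QP) (hpP : IsReesQuotientMap S pP)
    (pA : A → QA) (hpA : IsReesQuotientMap S pA)
    (g : QP → QA) (hg_equiv : ∀ (s : S) (q : QP), g (s • q) = s • g q)
    (hg_zero : g 0 = 0) (hg_comm : g ∘ pP = pA ∘ f) :
    PActProjective S QP ∧ Function.Surjective g ∧
      ∀ B : Set QP, IsPSubact S B → B ≠ Set.univ → g '' B ≠ Set.univ := by
  obtain ⟨hpP_surj, hpP_equiv, hpP_ker⟩ := hpP
  obtain ⟨hpA_surj, -, hpA_ker⟩ := hpA
  have hcomm (x : P) : g (pP x) = pA (f x) := congrFun hg_comm x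
  refine ⟨?_, ?_, ?_⟩
  · intro B C _ _ _ _ π k hπ_surj hπ_equiv _ hk_equiv _
    obtain ⟨h, hh_equiv, hh⟩ := hP_proj B C π (k ∘ pP) hπ_surj hπ_equiv
      fun s x => by simp only [Function.comp_apply, hpP_equiv, hk_equiv]
    have hh_fixed (x : P) (hx : (0 : S) • x = x) : h x = 0 := by
      rw [← hx, hh_equiv, zero_smul]
    have hh_factor (x y : P) (hxy : pP x = pP y) : h x = h y := by
      rcases (hpP_ker x y).1 hxy with rfl | ⟨hx, hy⟩
      · rfl
      · rw [hh_fixed x hx, hh_fixed y hy]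
    have hsec := Function.surjInv_eq hpP_surj
    have hequiv (s : S) (q : QP) : h (Function.surjInv hpP_surj (s • q)) =
        s • h (Function.surjInv hpP_surj q) := by
      rw [← hh_equiv]
      exact hh_factor _ _ (by rw [hpP_equiv, hsec, hsec])
    refine ⟨fun q => h (Function.surjInv hpP_surj q), hequiv, ?_, ?_⟩
    · simpa only [zero_smul] using hequiv 0 0
    · funext q
      simpa only [Function.comp_apply, hsec] using
        congrFun hh (Function.surjInv hpP_surj q)
  · exact Function.Surjective.of_comp (hg_comm ▸ hpA_surj.comp hf_surj)
  · rintro B ⟨hB_zero, hB_smul⟩ hB_ne hB_image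
    refine hf_cover (pP ⁻¹' B) ⟨?_, ?_⟩ ?_ ?_
    · exact Set.Nonempty.preimage ⟨0, hB_zero⟩ hpP_surj
    · intro s a ha
      rw [Set.mem_preimage, hpP_equiv]
      exact hB_smul s ha
    · rwa [Ne, Set.preimage_eq_univ_iff, hpP_surj.range_eq, Set.univ_subset_iff]
    · refine Set.eq_univ_of_forall fun a => ?_
      obtain ⟨b, hb, hba⟩ : pA a ∈ g '' B := hB_image ▸ Set.mem_univ _
      obtain ⟨x, rfl⟩ := hpP_surj b
      rcases (hpA_ker _ _).1 ((hcomm x).symm.trans hba) with hxa | ⟨-, ha⟩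
      · exact ⟨x, hb, hxa⟩
      · obtain ⟨y, rfl⟩ := hf_surj a
        refine ⟨(0 : S) • y, ?_, (hf_equiv 0 y).trans ha⟩
        rwa [Set.mem_preimage, hpP_equiv, zero_smul]
end

section
/- Let S be a monoid with zero (0 ≠ 1). If S is left 0-perfect, i.e. every pointed S-act admits a projective cover in the category of pointed S-acts, then S is left perfect, i.e. every nonempty S-act admits a projective cover in the category of S-acts. -/
universe u

/-- `f : P → A` is a projective cover of the `S`-act `A`: a surjective
equivariant map from a projective act which is not surjective when restricted
to any proper subact of `P`. -/
def IsProjCover (S : Type u) [Monoid S] (P : Type u) [MulAction S P]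
    (A : Type u) [MulAction S A] (f : P → A) : Prop :=
  Function.Surjective f ∧ (∀ (s : S) (x : P), f (s • x) = s • f x) ∧
    ActProjective S P ∧
    ∀ B : Set P, IsSubact S B → B ≠ Set.univ → f '' B ≠ Set.univ

/-- `f : P → A` is a projective cover of the pointed `S`-act `A` in the
category of pointed `S`-acts. -/
def IsPProjCover (S : Type u) [MonoidWithZero S] (P : Type u) [Zero P]
    [MulActionWithZero S P] (A : Type u) [Zero A] [MulActionWithZero S A]
    (f : P → A) : Prop :=
  Function.Surjective f ∧ f 0 = 0 ∧
    (∀ (s : S) (x : P), f (s • x) = s • f x) ∧ PActProjective S P ∧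
    ∀ B : Set P, IsPSubact S B → B ≠ Set.univ → f '' B ≠ Set.univ

/-- `S` is left perfect: every nonempty `S`-act admits a projective cover in
the category of `S`-acts. -/
def LeftPerfect (S : Type u) [Monoid S] : Prop :=
  ∀ (A : Type u) (instA : MulAction S A), Nonempty A →
    ∃ (P : Type u) (instP : MulAction S P) (f : P → A),
      @IsProjCover S _ P instP A instA f

/-- `S` is left 0-perfect: every pointed `S`-act admits a projective cover in
the category of pointed `S`-acts. -/
def Left0Perfect (S : Type u) [MonoidWithZero S] : Prop :=
  ∀ (A : Type u) (zA : Zero A) (instA : MulActionWithZero S A),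
    ∃ (P : Type u) (zP : Zero P) (instP : MulActionWithZero S P) (f : P → A),
      @IsPProjCover S _ P zP instP A zA instA f

/-- The disjoint union of the left ideals `S * e j`, as an `S`-act. -/
@[ext]
structure IdealSum {S J : Type u} [Monoid S] (e : J → S) : Type u where
  idx : J
  val : S
  val_mul : val * e idx = val

namespace IdealSum

variable {S J : Type u} [Monoid S] {e : J → S}

instance : MulAction S (IdealSum e) where
  smul s x := ⟨x.idx, s * x.val, by rw [mul_assoc, x.val_mul]⟩
  one_smul x := IdealSum.ext rfl (one_mul x.val)
  mul_smul s t x := IdealSum.ext rfl (mul_assoc s t x.val)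

@[simp] lemma smul_idx (s : S) (x : IdealSum e) : (s • x).idx = x.idx := rfl

@[simp] lemma smul_val (s : S) (x : IdealSum e) : (s • x).val = s * x.val := rfl

lemma smul_gen (he : ∀ j, e j * e j = e j) (x : IdealSum e) :
    x.val • (⟨x.idx, e x.idx, he _⟩ : IdealSum e) = x :=
  IdealSum.ext rfl x.val_mul

lemma actProjective (he : ∀ j, e j * e j = e j) : ActProjective S (IdealSum e) := by
  intro A B _ _ π f hπ hπs hf
  choose g hg using hπ
  refine ⟨fun x => x.val • g (f ⟨x.idx, e x.idx, he _⟩), fun s x => mul_smul _ _ _, ?_⟩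
  funext x
  rw [Function.comp_apply, hπs, hg, ← hf, smul_gen he]

end IdealSum

/-- The equivalence relation on an `S`-act identifying all the elements fixed by `0`. -/
def collapseSetoid (S A : Type u) [MonoidWithZero S] [MulAction S A] : Setoid A where
  r a b := a = b ∨ ((0 : S) • a = a ∧ (0 : S) • b = b)
  iseqv :=
    { refl := fun _ => Or.inl rfl
      symm := by rintro a b (h | h); exacts [Or.inl h.symm, Or.inr h.symm]
      trans := by
        rintro a b c (rfl | h) (rfl | h')
        exacts [Or.inl rfl, Or.inr h', Or.inr h, Or.inr ⟨h.1, h'.2⟩] }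

/-- The pointed `S`-act obtained from an `S`-act by identifying all its zeros. -/
def Collapse (S A : Type u) [MonoidWithZero S] [MulAction S A] : Type u :=
  Quotient (collapseSetoid S A)

namespace Collapse

variable {S A : Type u} [MonoidWithZero S] [MulAction S A]

/-- The quotient map. -/
def mk (S : Type u) {A : Type u} [MonoidWithZero S] [MulAction S A] (a : A) : Collapse S A :=
  Quotient.mk (collapseSetoid S A) a

lemma mk_surjective : Function.Surjective (mk S : A → Collapse S A) :=
  Quotient.mk_surjective

lemma mk_eq_mk {a b : A} :
    mk S a = mk S b ↔ a = b ∨ ((0 : S) • a = a ∧ (0 : S) • b = b) :=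
  Quotient.eq (r := collapseSetoid S A)

lemma zero_smul_smul (s : S) (a : A) : (0 : S) • s • a = (0 : S) • a := by
  rw [smul_smul, zero_mul]

lemma smul_zero_smul (s : S) (a : A) : s • (0 : S) • a = (0 : S) • a := by
  rw [smul_smul, mul_zero]

noncomputable instance [Nonempty A] : Zero (Collapse S A) :=
  ⟨mk S ((0 : S) • Classical.arbitrary A)⟩

lemma mk_eq_zero [Nonempty A] {a : A} : mk S a = 0 ↔ (0 : S) • a = a := by
  refine mk_eq_mk.trans ⟨?_, fun h => Or.inr ⟨h, zero_smul_smul _ _⟩⟩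
  rintro (rfl | h)
  exacts [zero_smul_smul _ _, h.1]

instance : SMul S (Collapse S A) where
  smul s := Quotient.map (sa := collapseSetoid S A) (sb := collapseSetoid S A) (s • ·) (by
    rintro a b (rfl | ⟨ha, hb⟩)
    · exact Or.inl rfl
    · refine Or.inr ⟨?_, ?_⟩
      · rw [zero_smul_smul, ← ha, zero_smul_smul, smul_zero_smul]
      · rw [zero_smul_smul, ← hb, zero_smul_smul, smul_zero_smul])

lemma mk_smul (s : S) (a : A) : mk S (s • a) = s • mk S a := rfl

noncomputable instance [Nonempty A] : MulActionWithZero S (Collapse S A) where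
  one_smul x := by
    obtain ⟨a, rfl⟩ := mk_surjective x
    rw [← mk_smul, one_smul]
  mul_smul s t x := by
    obtain ⟨a, rfl⟩ := mk_surjective x
    rw [← mk_smul, ← mk_smul, ← mk_smul, mul_smul]
  smul_zero s := by
    refine (mk_smul s _).symm.trans (mk_eq_zero.2 ?_)
    rw [smul_zero_smul, zero_smul_smul]
  zero_smul x := by
    obtain ⟨a, rfl⟩ := mk_surjective x
    rw [← mk_smul, mk_eq_zero, zero_smul_smul]

lemma eq_of_mk_eq [Nonempty A] {a b : A} (h : mk S a = mk S b) (h0 : mk S a ≠ 0) : a = b :=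
  (mk_eq_mk.1 h).resolve_right fun h' => h0 (mk_eq_zero.2 h'.1)

end Collapse

/-- Every element `x` of a pointed projective act has a coordinate `w x` with respect to a
generator `c x`, compatibly with the action away from `0`. -/
lemma PActProjective.exists_coord {S P : Type u} [MonoidWithZero S] [Zero P]
    [MulActionWithZero S P] (hP : PActProjective S P) :
    ∃ (c : P → P) (w : P → S), (∀ x, w x • c x = x) ∧
      ∀ (s : S) (x : P), s • x ≠ 0 → c (s • x) = c x ∧ w (s • x) = s * w x := by
  let e : P → S := fun _ => 1
  have : Nonempty (IdealSum e) := ⟨⟨0, 1, mul_one 1⟩⟩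
  let π : Collapse S (IdealSum e) → P := Quotient.lift (fun x => x.val • x.idx) (by
    rintro x y (rfl | ⟨hx, hy⟩)
    · rfl
    · rw [← hx, ← hy]
      simp)
  have hπ : ∀ x : IdealSum e, π (Collapse.mk S x) = x.val • x.idx := fun _ => rfl
  have hπs : ∀ (s : S) b, π (s • b) = s • π b := fun s b => by
    obtain ⟨x, rfl⟩ := Collapse.mk_surjective b
    rw [← Collapse.mk_smul, hπ, hπ, smul_smul]
    rfl
  have hπ0 : π 0 = 0 := by rw [← zero_smul S 0, hπs, zero_smul]
  obtain ⟨h, hs, -, hid⟩ := hP (Collapse S (IdealSum e)) P π id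
    (fun x => ⟨Collapse.mk S ⟨x, 1, mul_one 1⟩, one_smul S x⟩) hπs hπ0 (fun _ _ => rfl) rfl
  choose r hr using fun x => Collapse.mk_surjective (S := S) (h x)
  have hx : ∀ x, π (h x) = x := congrFun hid
  refine ⟨fun x => (r x).idx, fun x => (r x).val, fun x => ?_, fun s x hsx => ?_⟩
  · rw [← hπ, hr, hx]
  · have key : r (s • x) = s • r x := by
      refine Collapse.eq_of_mk_eq (S := S) (by rw [hr, hs, Collapse.mk_smul, hr]) ?_
      rw [hr]
      intro h0
      exact hsx (by rw [← hx (s • x), h0, hπ0])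
    simp only [key]
    exact ⟨rfl, rfl⟩

/-- if a monoid `S` with zero (`0 ≠ 1`) is left 0-perfect,
then it is left perfect. -/
theorem stmt_11 {S : Type u} [MonoidWithZero S] (h01 : (0 : S) ≠ 1)
    (h : Left0Perfect S) : LeftPerfect S := by
  intro A _ _
  obtain ⟨P, _, _, f, hfsurj, hf0, hfs, hP, hmin⟩ := h (Collapse S A) inferInstance inferInstance
  obtain ⟨c, w, hwc, hcoord⟩ := hP.exists_coord
  let I := {i : P // c i = i ∧ f i ≠ 0}
  let Z := {z : A // (0 : S) • z = z ∧ ∀ a : A, (0 : S) • a = z → a = z}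
  have ne_zero : ∀ i : I, i.1 ≠ 0 := fun i hi => i.2.2 (by rw [hi, hf0])
  have hwi : ∀ i : I, w i.1 • i.1 = i.1 := fun i => by
    have := hwc i.1
    rwa [i.2.1] at this
  choose r hr using fun x => Collapse.mk_surjective (S := S) (A := A) (f x)
  have hr0 : ∀ i : I, Collapse.mk S (r i.1) ≠ 0 := fun i => by rw [hr]; exact i.2.2
  let e : I ⊕ Z → S := Sum.elim (fun i => w i.1) (fun _ => 0)
  let g : I ⊕ Z → A := Sum.elim (fun i => r i.1) (fun z => z.1)
  have he : ∀ j, e j * e j = e j := by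
    rintro (i | z)
    · have := (hcoord (w i.1) i.1 (by rw [hwi]; exact ne_zero i)).2
      rw [hwi] at this
      exact this.symm
    · exact zero_mul 0
  have heg : ∀ j, e j • g j = g j := by
    rintro (i | z)
    · symm
      refine Collapse.eq_of_mk_eq (S := S) ?_ (hr0 i)
      change _ = Collapse.mk S (w i.1 • r i.1)
      rw [Collapse.mk_smul]
      change Collapse.mk S (r i.1) = _
      rw [hr, ← hfs, hwi]
    · exact z.2.1
  let F : IdealSum e → A := fun x => x.val • g x.idx
  have hFs : ∀ (s : S) x, F (s • x) = s • F x := fun s x => mul_smul _ _ _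
  have hgen : ∀ (s : S) (j : I ⊕ Z), ∃ x, F x = s • g j := fun s j =>
    ⟨⟨j, s * e j, by rw [mul_assoc, he]⟩, by
      change (s * e j) • g j = _
      rw [mul_smul, heg]⟩
  have hF1 : ∀ a : A, (0 : S) • a ≠ a → ∃ x, F x = a := by
    intro a ha
    obtain ⟨x, hx⟩ := hfsurj (Collapse.mk S a)
    have hmka : Collapse.mk S a ≠ 0 := fun h0 => ha (Collapse.mk_eq_zero.1 h0)
    have hx0 : x ≠ 0 := fun h0 => hmka (by rw [← hx, h0, hf0])
    have hcc : c (c x) = c x := by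
      have := (hcoord (w x) (c x) (by rwa [hwc])).1
      rw [hwc] at this
      exact this.symm
    have hfx : w x • f (c x) = Collapse.mk S a := by rw [← hfs, hwc, hx]
    have hfc : f (c x) ≠ 0 := fun h0 => hmka (by rw [← hfx, h0, smul_zero])
    obtain ⟨y, hy⟩ := hgen (w x) (Sum.inl ⟨c x, hcc, hfc⟩)
    refine ⟨y, hy.trans ?_⟩
    symm
    refine Collapse.eq_of_mk_eq (S := S) ?_ hmka
    rw [Collapse.mk_smul, ← hfx]
    exact congrArg _ (hr (c x)).symm
  refine ⟨IdealSum e, inferInstance, F, fun a => ?_, hFs, IdealSum.actProjective he, ?_⟩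
  · by_cases ha : (0 : S) • a = a
    · by_cases hiso : ∀ b : A, (0 : S) • b = a → b = a
      · obtain ⟨y, hy⟩ := hgen 1 (Sum.inr ⟨a, ha, hiso⟩)
        exact ⟨y, hy.trans (one_smul S a)⟩
      · push Not at hiso
        obtain ⟨b, hb, hba⟩ := hiso
        obtain ⟨y, hy⟩ := hF1 b fun h0 => hba (h0.symm.trans hb)
        exact ⟨(0 : S) • y, by rw [hFs, hy, hb]⟩
    · exact hF1 a ha
  · rintro B ⟨-, hB⟩ hBne himg
    have hgB : ∀ j, (⟨j, e j, he j⟩ : IdealSum e) ∈ B := by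
      rintro (i | z)
      · let C : Set P := {p | p = 0 ∨ ∃ x ∈ B, ∃ k : I, x.idx = Sum.inl k ∧ x.val • k.1 = p}
        have hC : IsPSubact S C := by
          refine ⟨Or.inl rfl, ?_⟩
          rintro s p (rfl | ⟨x, hx, k, hk, rfl⟩)
          · exact Or.inl (smul_zero s)
          · exact Or.inr ⟨s • x, hB s hx, k, hk, mul_smul _ _ _⟩
        have hCuniv : C = Set.univ := by
          by_contra hne
          refine hmin C hC hne (Set.eq_univ_of_forall fun b => ?_)
          obtain ⟨a, rfl⟩ := Collapse.mk_surjective b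
          obtain ⟨x, hx, rfl⟩ : a ∈ F '' B := himg ▸ Set.mem_univ a
          rcases hk : x.idx with k | z
          · refine ⟨x.val • k.1, Or.inr ⟨x, hx, k, hk, rfl⟩, ?_⟩
            simp only [F, hk]
            rw [Collapse.mk_smul, hfs]
            exact congrArg _ (hr k.1).symm
          · refine ⟨0, Or.inl rfl, ?_⟩
            rw [hf0]
            symm
            rw [Collapse.mk_eq_zero]
            simp only [F, hk, g, Sum.elim_inr]
            rw [← z.2.1, Collapse.smul_zero_smul, Collapse.zero_smul_smul]
        obtain h0 | ⟨x, hx, k, hk, hki⟩ : i.1 ∈ C := hCuniv ▸ Set.mem_univ i.1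
        · exact absurd h0 (ne_zero i)
        · obtain ⟨h1, h2⟩ := hcoord x.val k.1 (by rw [hki]; exact ne_zero i)
          rw [hki] at h1 h2
          have hik : i = k := Subtype.ext (i.2.1.symm.trans (h1.trans k.2.1))
          have hval := x.val_mul
          rw [hk] at hval
          convert hx using 1
          exact IdealSum.ext (by rw [hk, hik]) (h2.trans hval)
      · obtain ⟨x, hx, hxz⟩ : z.1 ∈ F '' B := himg ▸ Set.mem_univ z.1
        have h0 : (0 : S) • g x.idx = z.1 := by
          rw [← Collapse.zero_smul_smul x.val, ← z.2.1, ← hxz]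
        have hgz : g x.idx = z.1 := z.2.2 _ h0
        rcases hk : x.idx with k | z'
        · rw [hk] at hgz h0
          exact absurd (Collapse.mk_eq_zero.2 (h0.trans hgz.symm)) (hr0 k)
        · rw [hk] at hgz
          have hzz : z' = z := Subtype.ext hgz
          have hval := x.val_mul
          rw [hk] at hval
          convert hx using 1
          exact IdealSum.ext (by rw [hk, hzz]) ((mul_zero x.val).symm.trans hval)
    refine hBne (Set.eq_univ_of_forall fun x => ?_)
    rw [← IdealSum.smul_gen he x]
    exact hB _ (hgB _)
end

section
/- Let S be a monoid with zero (0 ≠ 1), let A be a nonempty S-act in which the set 0A of zero elements is a superfluous subact, and let p : A → Q realize the Rees quotient A/0A, where Q is a pointed S-act. Then A is hollow (as an S-act) if and only if Q is hollow (as a pointed S-act): B₁ ∪ B₂ ≠ A for all proper subacts B₁, B₂ ⊊ A if and only if C₁ ∪ C₂ ≠ Q for all proper subacts C₁, C₂ ⊊ Q. -/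
universe u

/-- if the set `0A` of zero elements of a nonempty `S`-act `A`
is a superfluous subact and `p : A → Q` realizes the Rees quotient `A/0A`,
then `A` is hollow (as an `S`-act) iff `Q` is hollow (as a pointed
`S`-act). -/
theorem stmt_13 {S : Type u} [MonoidWithZero S] (h01 : (0 : S) ≠ 1)
    {A : Type u} [MulAction S A] [Nonempty A]
    (hsup : ∀ C : Set A, IsSubact S C → C ≠ Set.univ →
      zeroSet S A ∪ C ≠ Set.univ)
    {Q : Type u} [Zero Q] [MulActionWithZero S Q]
    (p : A → Q) (hp : IsReesQuotientMap S p) :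
    (∀ B₁ B₂ : Set A, IsSubact S B₁ → IsSubact S B₂ →
        B₁ ≠ Set.univ → B₂ ≠ Set.univ → B₁ ∪ B₂ ≠ Set.univ) ↔
      (∀ C₁ C₂ : Set Q, IsPSubact S C₁ → IsPSubact S C₂ →
        C₁ ≠ Set.univ → C₂ ≠ Set.univ → C₁ ∪ C₂ ≠ Set.univ) := by
  obtain ⟨hsurj, hequiv, hker⟩ := hp
  constructor
  · intro hA C₁ C₂ h₁ h₂ n₁ n₂ hC
    have preimage_subact : ∀ C : Set Q, IsPSubact S C → IsSubact S (p ⁻¹' C) := by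
      intro C hC
      obtain ⟨a, ha⟩ := hsurj 0
      refine ⟨⟨a, by simpa [ha] using hC.1⟩, fun s b hb => ?_⟩
      rw [Set.mem_preimage, hequiv]
      exact hC.2 s hb
    have preimage_proper : ∀ C : Set Q, C ≠ Set.univ → p ⁻¹' C ≠ Set.univ :=
      fun C hC h => hC (hsurj.preimage_injective (h.trans Set.preimage_univ.symm))
    exact hA _ _ (preimage_subact _ h₁) (preimage_subact _ h₂)
      (preimage_proper _ n₁) (preimage_proper _ n₂)
      (by rw [← Set.preimage_union, hC, Set.preimage_univ])
  · intro hQ B₁ B₂ h₁ h₂ n₁ n₂ hB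
    have image_subact : ∀ B : Set A, IsSubact S B → IsPSubact S (p '' B) := by
      rintro B ⟨⟨b, hb⟩, hsmul⟩
      refine ⟨⟨(0 : S) • b, hsmul 0 hb, by rw [hequiv, zero_smul]⟩, ?_⟩
      rintro s _ ⟨a, ha, rfl⟩
      exact ⟨s • a, hsmul s ha, hequiv s a⟩
    have image_proper : ∀ B : Set A, IsSubact S B → B ≠ Set.univ →
        p '' B ≠ Set.univ := by
      intro B hB hne h
      refine hsup B hB hne (Set.eq_univ_of_forall fun a => ?_)
      obtain ⟨b, hb, hba⟩ : p a ∈ p '' B := h ▸ Set.mem_univ _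
      rcases (hker b a).1 hba with rfl | ⟨-, ha⟩
      · exact Or.inr hb
      · exact Or.inl ha
    exact hQ _ _ (image_subact _ h₁) (image_subact _ h₂)
      (image_proper _ h₁ n₁) (image_proper _ h₂ n₂)
      (by rw [← Set.image_union, hB, Set.image_univ, hsurj.range_eq])
end

section
/- Let S be a monoid with zero (0 ≠ 1). Then S is left 0-steady (every compact pointed S-act is cyclic) if and only if S satisfies the ascending chain condition on cyclic subacts: for every S-act A and every sequence (a_n)_{n∈ℕ} in A with S • a_n ⊆ S • a_{n+1} for all n, there exists N such that S • a_n = S • a_N for all n ≥ N. -/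
universe u

/-- A pointed `S`-act `C` is compact: every equivariant zero-preserving map
from `C` into a coproduct `W = {(xᵢ) ∈ ∏ᵢ Aᵢ | at most one xᵢ ≠ 0}` of a
family of pointed `S`-acts factors through a single summand, i.e. there is a
single index `j` with `(f c)ᵢ = 0` for every `c ∈ C` and every `i ≠ j`. -/
def PCompact (S : Type u) [MonoidWithZero S] (C : Type u) [Zero C]
    [MulActionWithZero S C] : Prop :=
  ∀ (I : Type u) [Nonempty I] (A : I → Type u) [∀ i, Zero (A i)]
    [∀ i, MulActionWithZero S (A i)] (f : C → ∀ i, A i),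
    (∀ c : C, ∀ i j : I, f c i ≠ 0 → f c j ≠ 0 → i = j) →
    (∀ (s : S) (c : C), f (s • c) = s • f c) → f 0 = 0 →
    ∃ j : I, ∀ (c : C) (i : I), i ≠ j → f c i = 0

/-- `S` is left 0-steady: every compact pointed `S`-act is cyclic. -/
def Left0Steady (S : Type u) [MonoidWithZero S] : Prop :=
  ∀ (C : Type u) [Zero C] [MulActionWithZero S C],
    PCompact S C → ∃ g : C, ∀ c : C, ∃ s : S, c = s • g

/-- `S` satisfies the ascending chain condition on cyclic subacts of
arbitrary `S`-acts. -/
def ACCCyclic (S : Type u) [Monoid S] : Prop :=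
  ∀ (A : Type u) [MulAction S A] (a : ℕ → A),
    (∀ n, {x : A | ∃ s : S, x = s • a n} ⊆ {x : A | ∃ s : S, x = s • a (n + 1)}) →
    ∃ N, ∀ n, N ≤ n → {x : A | ∃ s : S, x = s • a n} = {x : A | ∃ s : S, x = s • a N}

/-- The Rees quotient of a pointed act `C` by a subact `B`, realised on the elements of `C`
that are zero or lie outside `B`. -/
def ReesQuotient {S C : Type u} [MonoidWithZero S] [Zero C] [MulActionWithZero S C]
    (B : SubMulAction S C) : Type u :=
  {c : C // c ∈ B → c = 0}

namespace ReesQuotient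

variable {S C : Type u} [MonoidWithZero S] [Zero C] [MulActionWithZero S C]
  {B : SubMulAction S C}

instance : Zero (ReesQuotient B) := ⟨⟨0, fun _ => rfl⟩⟩

open Classical in
/-- The canonical projection `C → C / B`. -/
noncomputable def mk (B : SubMulAction S C) (c : C) : ReesQuotient B :=
  if h : c ∈ B then 0 else ⟨c, fun hc => absurd hc h⟩

theorem mk_of_mem {c : C} (h : c ∈ B) : mk B c = 0 := dif_pos h

theorem mk_val_of_notMem {c : C} (h : c ∉ B) : (mk B c).1 = c :=
  congrArg Subtype.val (dif_neg h)

theorem mk_zero : mk B 0 = 0 := by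
  by_cases h : (0 : C) ∈ B
  · exact mk_of_mem h
  · exact Subtype.ext (mk_val_of_notMem h)

theorem mk_val (x : ReesQuotient B) : mk B x.1 = x := by
  by_cases h : x.1 ∈ B
  · rw [mk_of_mem h]
    exact Subtype.ext (x.2 h).symm
  · exact Subtype.ext (mk_val_of_notMem h)

theorem mk_eq_zero_iff (h0 : (0 : C) ∈ B) {c : C} : mk B c = 0 ↔ c ∈ B := by
  refine ⟨fun h => ?_, mk_of_mem⟩
  by_contra hc
  have h' : c = 0 := (mk_val_of_notMem hc).symm.trans (congrArg Subtype.val h)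
  exact hc (h' ▸ h0)

noncomputable instance : SMul S (ReesQuotient B) := ⟨fun s x => mk B (s • x.1)⟩

theorem mk_smul (s : S) (c : C) : mk B (s • c) = s • mk B c := by
  change _ = mk B (s • (mk B c).1)
  by_cases h : c ∈ B
  · rw [mk_of_mem h, mk_of_mem (B.smul_mem s h)]
    change 0 = mk B (s • (0 : C))
    rw [smul_zero, mk_zero]
  · rw [mk_val_of_notMem h]

noncomputable instance : MulActionWithZero S (ReesQuotient B) where
  one_smul x := by
    conv_lhs => rw [← mk_val x, ← mk_smul, one_smul, mk_val]
  mul_smul s t x := by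
    rw [← mk_val x, ← mk_smul, ← mk_smul, ← mk_smul, mul_smul]
  smul_zero s := by
    rw [← mk_zero, ← mk_smul, smul_zero]
  zero_smul x := by
    rw [← mk_val x, ← mk_smul, zero_smul, mk_zero]

end ReesQuotient

/-- If the complements of a family of subacts of a compact act are pairwise disjoint, then
all but at most one of these subacts are everything. -/
theorem PCompact.exists_forall_mem {S C : Type u} [MonoidWithZero S] [Zero C]
    [MulActionWithZero S C] (hC : PCompact S C) {I : Type u} [Nonempty I]
    (B : I → SubMulAction S C) (h0 : ∀ i, (0 : C) ∈ B i)
    (hB : ∀ c i j, c ∉ B i → c ∉ B j → i = j) :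
    ∃ j, ∀ c i, i ≠ j → c ∈ B i := by
  obtain ⟨j, hj⟩ := hC I (fun i => ReesQuotient (B i)) (fun c i => ReesQuotient.mk (B i) c)
    (fun c i j hi hj => hB c i j (fun h => hi (ReesQuotient.mk_of_mem h))
      (fun h => hj (ReesQuotient.mk_of_mem h)))
    (fun s c => funext fun i => ReesQuotient.mk_smul s c)
    (funext fun i => ReesQuotient.mk_zero)
  exact ⟨j, fun c i hi => (ReesQuotient.mk_eq_zero_iff (h0 i)).1 (hj c i hi)⟩

/-- Under the ascending chain condition, every nonempty act has a maximal cyclic subact. -/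
theorem ACCCyclic.exists_maximal {S : Type u} [Monoid S] (h : ACCCyclic S) (A : Type u)
    [MulAction S A] [Nonempty A] :
    ∃ g : A, ∀ c : A, (∃ s : S, g = s • c) → ∃ s : S, c = s • g := by
  by_contra! hne
  choose next hnext hlt using hne
  obtain ⟨a₀⟩ := ‹Nonempty A›
  let a : ℕ → A := fun n => next^[n] a₀
  have ha : ∀ n, a (n + 1) = next (a n) := fun n => Function.iterate_succ_apply' next n a₀
  obtain ⟨N, hN⟩ := h A a (by
    rintro n x ⟨s, rfl⟩
    obtain ⟨t, ht⟩ := hnext (a n)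
    exact ⟨s * t, by rw [mul_smul, ha, ← ht]⟩)
  have hmem : a (N + 1) ∈ {x : A | ∃ s : S, x = s • a N} :=
    hN (N + 1) N.le_succ ▸ ⟨1, (one_smul S _).symm⟩
  obtain ⟨s, hs⟩ := hmem
  exact hlt (a N) s (by rw [← ha, hs])

/-- The subact of all elements that do not generate `g`. -/
def notGenerating {S A : Type u} [Monoid S] [MulAction S A] (g : A) : SubMulAction S A where
  carrier := {c | ¬ ∃ s : S, g = s • c}
  smul_mem' := fun t _ hc ⟨s, hs⟩ => hc ⟨s * t, by rw [mul_smul, hs]⟩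

/-- The cyclic subact generated by `g`. -/
def cyclicSubact (S : Type u) {A : Type u} [Monoid S] [MulAction S A] (g : A) :
    SubMulAction S A where
  carrier := {c | ∃ s : S, c = s • g}
  smul_mem' := by
    rintro t _ ⟨s, rfl⟩
    exact ⟨t * s, (mul_smul t s g).symm⟩

theorem ACCCyclic.left0Steady {S : Type u} [MonoidWithZero S] (h : ACCCyclic S) :
    Left0Steady S := by
  intro C _ _ hC
  have : Nonempty C := ⟨0⟩
  obtain ⟨g, hg⟩ := h.exists_maximal C
  refine ⟨g, ?_⟩
  by_cases hg0 : g = 0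
  · exact fun c => hg c ⟨0, by rw [zero_smul, hg0]⟩
  let B : ULift.{u} Bool → SubMulAction S C := fun i =>
    if i.down then cyclicSubact S g else notGenerating g
  have hcov : ∀ c, c ∉ cyclicSubact S g → c ∉ notGenerating (S := S) g → False :=
    fun c h₁ h₂ => h₁ (hg c (not_not.1 h₂))
  obtain ⟨⟨j⟩, hj⟩ := hC.exists_forall_mem B
    (by
      rintro ⟨_ | _⟩
      · rintro ⟨s, hs⟩
        exact hg0 (by rw [hs, smul_zero])
      · exact ⟨0, (zero_smul S g).symm⟩)
    (by
      rintro c ⟨_ | _⟩ ⟨_ | _⟩ h₁ h₂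
      · rfl
      · exact (hcov c h₂ h₁).elim
      · exact (hcov c h₁ h₂).elim
      · rfl)
  cases j
  · exact fun c => hj c ⟨true⟩ (by simp)
  · exact absurd ⟨1, (one_smul S g).symm⟩ (hj g ⟨false⟩ (by simp))

/-- The union of an ascending chain of cyclic subacts. -/
def chainUnion (S : Type u) {A : Type u} [Monoid S] [MulAction S A] (a : ℕ → A) :
    SubMulAction S A where
  carrier := {x | ∃ n, x ∈ cyclicSubact S (a n)}
  smul_mem' := fun t _ ⟨n, hn⟩ => ⟨n, (cyclicSubact S (a n)).smul_mem t hn⟩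

theorem Left0Steady.accCyclic {S : Type u} [MonoidWithZero S] (h : Left0Steady S) :
    ACCCyclic S := by
  intro A _ a hmono
  have hle : Monotone fun n => {x : A | ∃ s : S, x = s • a n} := monotone_nat_of_le_succ hmono
  have hself : ∀ n, a n ∈ {x : A | ∃ s : S, x = s • a n} := fun n => ⟨1, (one_smul S _).symm⟩
  have hzero : ∀ n, (0 : S) • a n = (0 : S) • a 0 := by
    intro n
    obtain ⟨s, hs⟩ := hle n.zero_le (hself 0)
    rw [hs, ← mul_smul, zero_mul]
  let U := chainUnion S a
  let _ : Zero U := ⟨⟨(0 : S) • a 0, 0, 0, rfl⟩⟩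
  let _ : MulActionWithZero S U :=
    { (inferInstance : MulAction S U) with
      smul_zero := fun s => Subtype.ext <| by
        change s • (0 : S) • a 0 = (0 : S) • a 0
        rw [← mul_smul, mul_zero]
      zero_smul := by
        rintro ⟨_, n, s, rfl⟩
        refine Subtype.ext ?_
        change (0 : S) • s • a n = (0 : S) • a 0
        rw [← mul_smul, zero_mul, hzero] }
  let b : ℕ → U := fun n => ⟨a n, n, hself n⟩
  have hb : ∀ m n, m ≤ n → ∃ s : S, b m = s • b n := fun m n hmn => by
    obtain ⟨s, hs⟩ := hle hmn (hself m)
    exact ⟨s, Subtype.ext hs⟩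
  have hU : ∀ c : U, ∃ n, ∃ s : S, c = s • b n := by
    rintro ⟨_, n, s, rfl⟩
    exact ⟨n, s, rfl⟩
  have hcomp : PCompact S U := by
    intro I _ B _ _ f hf hfs _
    have hpull : ∀ c i, f c i ≠ 0 → ∃ n, ∀ m, n ≤ m → f (b m) i ≠ 0 := by
      intro c i hc
      obtain ⟨n, s, rfl⟩ := hU c
      refine ⟨n, fun m hnm hm => hc ?_⟩
      obtain ⟨t, ht⟩ := hb n m hnm
      rw [ht, hfs, hfs, Pi.smul_apply, Pi.smul_apply, hm, smul_zero, smul_zero]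
    by_cases hne : ∃ c i, f c i ≠ 0
    · obtain ⟨c, j, hc⟩ := hne
      refine ⟨j, fun d i hij => by_contra fun hd => hij ?_⟩
      obtain ⟨n, hn⟩ := hpull c j hc
      obtain ⟨m, hm⟩ := hpull d i hd
      exact hf _ i j (hm _ (le_max_right n m)) (hn _ (le_max_left n m))
    · push Not at hne
      exact ⟨Classical.arbitrary I, fun c i _ => hne c i⟩
  obtain ⟨g, hg⟩ := h U hcomp
  obtain ⟨N, t, rfl⟩ := hU g
  refine ⟨N, fun n hn => (hle hn).antisymm' ?_⟩
  rintro _ ⟨s, rfl⟩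
  obtain ⟨r, hr⟩ := hg (b n)
  have hr' : a n = r • t • a N := congrArg Subtype.val hr
  exact ⟨s * (r * t), by rw [mul_smul, mul_smul, ← hr']⟩

/-- a monoid `S` with zero (`0 ≠ 1`) is left 0-steady iff it
satisfies the ascending chain condition on cyclic subacts. -/
theorem stmt_14 {S : Type u} [MonoidWithZero S] (h01 : (0 : S) ≠ 1) :
    Left0Steady S ↔ ACCCyclic S :=
  ⟨Left0Steady.accCyclic, ACCCyclic.left0Steady⟩
end

section
/- Let S be a monoid with zero (0 ≠ 1). Then every nonempty hollow S-act is cyclic if and only if every hollow pointed S-act is cyclic. -/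
universe u

/-- An `S`-act is hollow if the union of any two proper subacts is proper. -/
def ActHollow (S : Type u) [Monoid S] (A : Type u) [MulAction S A] : Prop :=
  ∀ B₁ B₂ : Set A, IsSubact S B₁ → IsSubact S B₂ →
    B₁ ≠ Set.univ → B₂ ≠ Set.univ → B₁ ∪ B₂ ≠ Set.univ

/-- A pointed `S`-act is hollow if the union of any two proper subacts is
proper. -/
def PActHollow (S : Type u) [MonoidWithZero S] (A : Type u) [Zero A]
    [MulActionWithZero S A] : Prop :=
  ∀ C₁ C₂ : Set A, IsPSubact S C₁ → IsPSubact S C₂ →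
    C₁ ≠ Set.univ → C₂ ≠ Set.univ → C₁ ∪ C₂ ≠ Set.univ

/-- Over a monoid with zero, all elements of a hollow act have the same image under `0`. -/
theorem ActHollow.zero_smul_eq {S : Type u} [MonoidWithZero S] {A : Type u} [MulAction S A]
    (hA : ActHollow S A) (a b : A) : (0 : S) • a = (0 : S) • b := by
  have key : ∀ (s : S) (x : A), (0 : S) • s • x = (0 : S) • x := fun s x => by
    rw [smul_smul, zero_mul]
  by_contra hne
  refine hA {x | (0 : S) • x = (0 : S) • b} {x | (0 : S) • x ≠ (0 : S) • b}
    ⟨⟨b, rfl⟩, fun s x hx => (key s x).trans hx⟩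
    ⟨⟨a, hne⟩, fun s x hx h => hx ((key s x).symm.trans h)⟩
    (fun h => hne (Set.eq_univ_iff_forall.mp h a))
    (fun h => Set.eq_univ_iff_forall.mp h b rfl)
    (Set.eq_univ_iff_forall.mpr fun x => em _)

/-- A nonempty subact of a pointed act is a pointed subact. -/
theorem IsSubact.isPSubact {S : Type u} [MonoidWithZero S] {A : Type u} [Zero A]
    [MulActionWithZero S A] {B : Set A} (hB : IsSubact S B) : IsPSubact S B := by
  obtain ⟨⟨b, hb⟩, hs⟩ := hB
  exact ⟨zero_smul S b ▸ hs 0 hb, hs⟩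

/-- over a monoid `S` with zero (`0 ≠ 1`), every nonempty
hollow `S`-act is cyclic iff every hollow pointed `S`-act is cyclic. -/
theorem stmt_16 (S : Type u) [MonoidWithZero S] (h01 : (0 : S) ≠ 1) :
    (∀ (A : Type u) [MulAction S A], Nonempty A → ActHollow S A →
        ∃ g : A, ∀ a : A, ∃ s : S, a = s • g) ↔
      (∀ (A : Type u) [Zero A] [MulActionWithZero S A], PActHollow S A →
        ∃ g : A, ∀ a : A, ∃ s : S, a = s • g) := by
  constructor
  · intro h A _ _ hA
    exact h A ⟨0⟩ fun B₁ B₂ h₁ h₂ => hA B₁ B₂ h₁.isPSubact h₂.isPSubact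
  · intro h A _ ⟨a⟩ hA
    let : Zero A := ⟨(0 : S) • a⟩
    let : MulActionWithZero S A :=
      { smul_zero := fun s => show s • (0 : S) • a = (0 : S) • a by rw [smul_smul, mul_zero]
        zero_smul := fun x => hA.zero_smul_eq x a }
    exact h A fun C₁ C₂ h₁ h₂ => hA C₁ C₂ ⟨⟨0, h₁.1⟩, h₁.2⟩ ⟨⟨0, h₂.1⟩, h₂.2⟩
end
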